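/- Let Γ be a Hopfian group in which the intersection of all maximal nilpotent subgroups is the trivial subgroup, and let G be a nilpotent group. Then every automorphism f of the direct product Γ × G has the form f(γ, g) = (α(γ), ρ(γ)·L(g)), where α is an automorphism of Γ, L is an automorphism of G, and ρ : Γ → Z(G) is a group homomorphism into the center of G. -/

import Mathlib

/-- A subgroup is maximal nilpotent if it is nilpotent and maximal (w.r.t. inclusion)
among nilpotent subgroups. -/
def IsMaximalNilpotentSubgroup {G : Type*} [Group G] (H : Subgroup G) : Prop :=
  Group.IsNilpotent H ∧ ∀ K : Subgroup G, Group.IsNilpotent K → H ≤ K → K = H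

/-- A group is Hopfian if every surjective endomorphism is injective. -/
def IsHopfianGroup (G : Type*) [Group G] : Prop :=
  ∀ φ : G →* G, Function.Surjective φ → Function.Injective φ

theorem Subgroup.isNilpotent_map {A B : Type*} [Group A] [Group B] (φ : A →* B)
    (K : Subgroup A) (hK : Group.IsNilpotent K) : Group.IsNilpotent (K.map φ) :=
  Group.nilpotent_of_surjective (φ.subgroupMap K) (φ.subgroupMap_surjective K)

theorem Subgroup.isNilpotent_prod {A B : Type*} [Group A] [Group B]
    (H : Subgroup A) (K : Subgroup B) (hH : Group.IsNilpotent H) (hK : Group.IsNilpotent K) :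
    Group.IsNilpotent (H.prod K) :=
  Group.nilpotent_of_mulEquiv (Subgroup.prodEquiv H K).symm

/-- An automorphism of `Γ × G`, with `G` nilpotent, sends `1 × G` into `H × G` for every maximal
nilpotent subgroup `H` of `Γ`. -/
theorem IsMaximalNilpotentSubgroup.fst_apply_one_mem {Γ G : Type*} [Group Γ] [Group G]
    [hG : Group.IsNilpotent G] {H : Subgroup Γ} (hH : IsMaximalNilpotentSubgroup H)
    (f : MulAut (Γ × G)) (g : G) : (f (1, g)).1 ∈ H := by
  have hT : Group.IsNilpotent (⊤ : Subgroup G) := Group.isNilpotent_top.2 hG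
  set K : Subgroup Γ :=
    ((H.prod ⊤).map f.symm.toMonoidHom).map (MonoidHom.fst Γ G) with hK
  have hKn : Group.IsNilpotent K :=
    Subgroup.isNilpotent_map _ _
      (Subgroup.isNilpotent_map _ _ (Subgroup.isNilpotent_prod _ _ hH.1 hT))
  set M : Subgroup Γ := ((K.prod ⊤).map f.toMonoidHom).map (MonoidHom.fst Γ G) with hM
  have hMn : Group.IsNilpotent M :=
    Subgroup.isNilpotent_map _ _
      (Subgroup.isNilpotent_map _ _ (Subgroup.isNilpotent_prod _ _ hKn hT))
  have hHM : H ≤ M := fun x hx =>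
    ⟨(x, 1), ⟨f.symm (x, 1), ⟨⟨f.symm (x, 1), ⟨(x, 1), ⟨hx, trivial⟩, rfl⟩, rfl⟩, trivial⟩,
      f.apply_symm_apply (x, 1)⟩, rfl⟩
  rw [← hH.2 M hMn hHM]
  exact ⟨f (1, g), ⟨(1, g), ⟨K.one_mem, trivial⟩, rfl⟩, rfl⟩

/-- If `Γ` is Hopfian with trivial intersection of maximal nilpotent subgroups and `G` is
nilpotent, then every automorphism `f` of `Γ × G` has the form
`f(γ, g) = (α(γ), ρ(γ)·L(g))` with `α ∈ Aut Γ`, `L ∈ Aut G` and `ρ : Γ → Z(G)` a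
homomorphism into the center of `G`. -/
theorem stmt_4 (Γ G : Type*) [Group Γ] [Group G] [Group.IsNilpotent G]
    (hHopf : IsHopfianGroup Γ)
    (hΓ : sInf {H : Subgroup Γ | IsMaximalNilpotentSubgroup H} = ⊥)
    (f : MulAut (Γ × G)) :
    ∃ (α : MulAut Γ) (L : MulAut G) (ρ : Γ →* G),
      (∀ γ : Γ, ρ γ ∈ Subgroup.center G) ∧
      ∀ (γ : Γ) (g : G), f (γ, g) = (α γ, ρ γ * L g) := by
  have hfst (g : G) : (f (1, g)).1 = 1 := by
    rw [← Subgroup.mem_bot, ← hΓ, Subgroup.mem_sInf]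
    exact fun H hH => hH.fst_apply_one_mem f g
  have hsplit (γ : Γ) (g : G) : f (γ, g) = f (γ, 1) * f (1, g) := by
    rw [← map_mul]; simp
  let a : Γ →* Γ := (MonoidHom.fst Γ G).comp (f.toMonoidHom.comp (MonoidHom.inl Γ G))
  let ρ : Γ →* G := (MonoidHom.snd Γ G).comp (f.toMonoidHom.comp (MonoidHom.inl Γ G))
  let l : G →* G := (MonoidHom.snd Γ G).comp (f.toMonoidHom.comp (MonoidHom.inr Γ G))
  have hf (γ : Γ) (g : G) : f (γ, g) = (a γ, ρ γ * l g) := by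
    rw [hsplit]
    refine Prod.ext ?_ rfl
    change (f (γ, 1)).1 * (f (1, g)).1 = (f (γ, 1)).1
    rw [hfst, mul_one]
  have ha_surj : Function.Surjective a := fun x => by
    obtain ⟨⟨γ, g⟩, h⟩ := f.surjective (x, 1)
    rw [hf] at h
    exact ⟨γ, congrArg Prod.fst h⟩
  have ha_inj : Function.Injective a := hHopf a ha_surj
  have hl_inj : Function.Injective l := fun x y h => by
    have : f (1, x) = f (1, y) := by rw [hf, hf, h]
    exact congrArg Prod.snd (f.injective this)
  have hl_surj : Function.Surjective l := fun x => by
    obtain ⟨⟨γ, g⟩, h⟩ := f.surjective (1, x)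
    rw [hf, Prod.mk.injEq] at h
    obtain rfl : γ = 1 := ha_inj (h.1.trans a.map_one.symm)
    exact ⟨g, by simpa using h.2⟩
  refine ⟨MulEquiv.ofBijective a ⟨ha_inj, ha_surj⟩, MulEquiv.ofBijective l ⟨hl_inj, hl_surj⟩, ρ,
    fun γ => Subgroup.mem_center_iff.2 fun x => ?_, hf⟩
  obtain ⟨g, rfl⟩ := hl_surj x
  have h : f (1, g) * f (γ, 1) = f (γ, 1) * f (1, g) := by
    rw [← map_mul, ← map_mul]; simp
  exact congrArg Prod.snd h
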